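/- arXiv:2106.14869 — 2 statements merged into one kernel-verified Lean document; each statement's English description precedes it below -/
import Mathlib

section
/- Let G be a finite simple bipartite graph between parts V_d and V_c that is biregular (all vertices of V_d have the same degree and all vertices of V_c have the same degree) with at least one edge, and assume |V_c| ≥ 3. Let {A_1, A_2} be a partition of V_d into two blocks of equal size, and let (Q_1, Q_2, Q_3) be a partition of V_d into three nonempty blocks that refines {A_1, A_2}. Then there exist distinct vertices w_1, w_2, w_3 ∈ V_c such that for every r ∈ {1,2,3} there is some v ∈ Q_r with v w_r ∈ E(G). Moreover, if {P_1, P_2} is a partition of V_c into two nonempty blocks, then w_1, w_2, w_3 can additionally be chosen so that at most two of them lie in P_1 and at most two of them lie in P_2. (This is the 'expand-with-two-twins' claim in the proof of the disjoint-subtrees lemma.) -/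
open Classical in
/-- Double counting: if every vertex of `X` has at least `m` neighbours in `Y` and every vertex of `Y`
has at most `n` neighbours in `X`, then sets in `X` expand by a factor of at least `m / n`. -/
lemma SimpleGraph.ncard_mul_le_ncard_neighbors_mul {V : Type*} [Fintype V] (G : SimpleGraph V)
    {X Y T : Set V} {m n : ℕ} (hT : T ⊆ X)
    (hX : ∀ u ∈ X, m ≤ {w ∈ Y | G.Adj u w}.ncard)
    (hY : ∀ w ∈ Y, {u ∈ X | G.Adj u w}.ncard ≤ n) :
    T.ncard * m ≤ {w ∈ Y | ∃ u ∈ T, G.Adj u w}.ncard * n := by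
  rw [Set.ncard_eq_toFinset_card', Set.ncard_eq_toFinset_card']
  refine Finset.card_mul_le_card_mul G.Adj (fun u hu => ?_) (fun w hw => ?_)
  · have hu' : u ∈ T := by simpa using hu
    refine (hX u (hT hu')).trans ?_
    rw [← Set.ncard_coe_finset]
    refine Set.ncard_le_ncard (fun w hw => ?_) (Set.toFinite _)
    simpa [Finset.bipartiteAbove] using ⟨⟨hw.1, u, hu', hw.2⟩, hw.2⟩
  · have hw' : w ∈ Y := by
      have := Set.mem_toFinset.mp hw
      exact this.1
    refine le_trans ?_ (hY w hw')
    rw [← Set.ncard_coe_finset]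
    refine Set.ncard_le_ncard (fun u hu => ?_) (Set.toFinite _)
    have hu' : u ∈ T ∧ G.Adj u w := by simpa [Finset.bipartiteBelow] using hu
    exact ⟨hT hu'.1, hu'.2⟩

/-- At most two elements of a triple that is not contained in `P` lie in `P`. -/
lemma Set.ncard_triple_inter_le_two {V : Type*} (w : Fin 3 → V) {P : Set V} {r : Fin 3}
    (hr : w r ∉ P) : (({w 0, w 1, w 2} : Set V) ∩ P).ncard ≤ 2 := by
  have hsub : ({w 0, w 1, w 2} : Set V) ∩ P ⊆
      w '' ((Finset.univ.erase r : Finset (Fin 3)) : Set _) := by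
    rintro x ⟨hx, hxP⟩
    obtain ⟨i, rfl⟩ : ∃ i, w i = x := by
      rcases hx with rfl | rfl | rfl
      exacts [⟨0, rfl⟩, ⟨1, rfl⟩, ⟨2, rfl⟩]
    refine ⟨i, ?_, rfl⟩
    have : i ≠ r := by rintro rfl; exact hr hxP
    simpa using this
  refine (Set.ncard_le_ncard hsub (Set.toFinite _)).trans
    ((Set.ncard_image_le (Set.toFinite _)).trans ?_)
  rw [Set.ncard_coe_finset, Finset.card_erase_of_mem (Finset.mem_univ r)]
  simp

/-- A transversal contained in one side `P` can be changed in one place so that it meets both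
`P` and a set `P'` disjoint from it. -/
lemma exists_transversal_meeting_both {V : Type*} {R : Fin 3 → V → Prop} {P P' : Set V}
    (hdisj : Disjoint P P') {w : Fin 3 → V} (hinj : Function.Injective w)
    (hw : ∀ r, R r (w r)) (hwP : ∀ r, w r ∈ P) {x : V} (hx : x ∈ P') (hxR : ∃ r, R r x) :
    ∃ w' : Fin 3 → V, Function.Injective w' ∧ (∀ r, R r (w' r)) ∧
      (∃ r, w' r ∉ P) ∧ ∃ r, w' r ∉ P' := by
  obtain ⟨r, hr⟩ := hxR
  have hxP : x ∉ P := fun h => Set.disjoint_left.mp hdisj h hx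
  have hne : ∀ i, w i ≠ x := fun i h => hxP (h ▸ hwP i)
  obtain ⟨s, hs⟩ := exists_ne r
  refine ⟨Function.update w r x, ?_, ?_, ⟨r, by simpa using hxP⟩, ⟨s, ?_⟩⟩
  · intro i j hij
    by_cases hi : i = r <;> by_cases hj : j = r
    · exact hi.trans hj.symm
    · subst hi
      rw [Function.update_self, Function.update_of_ne hj] at hij
      exact (hne j hij.symm).elim
    · subst hj
      rw [Function.update_self, Function.update_of_ne hi] at hij
      exact (hne i hij).elim
    · rw [Function.update_of_ne hi, Function.update_of_ne hj] at hij
      exact hinj hij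
  · intro i
    by_cases hi : i = r
    · subst hi; simpa using hr
    · simpa [Function.update_of_ne hi] using hw i
  · rw [Function.update_of_ne hs]
    exact Set.disjoint_left.mp hdisj (hwP s)


theorem stmt7 {V : Type*} [Fintype V] (G : SimpleGraph V) (Vd Vc : Set V)
    (hdisj : Disjoint Vd Vc)
    (hbip : ∀ x y : V, G.Adj x y → (x ∈ Vd ∧ y ∈ Vc) ∨ (x ∈ Vc ∧ y ∈ Vd))
    (d₁ d₂ : ℕ)
    (hreg₁ : ∀ u ∈ Vd, {w ∈ Vc | G.Adj u w}.ncard = d₁)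
    (hreg₂ : ∀ w ∈ Vc, {u ∈ Vd | G.Adj u w}.ncard = d₂)
    (hedge : ∃ x y : V, G.Adj x y)
    (hVc : 3 ≤ Vc.ncard)
    (A₁ A₂ : Set V) (hAunion : A₁ ∪ A₂ = Vd) (hAdisj : Disjoint A₁ A₂)
    (hAsize : A₁.ncard = A₂.ncard)
    (Q : Fin 3 → Set V) (hQne : ∀ r, (Q r).Nonempty)
    (hQunion : Q 0 ∪ Q 1 ∪ Q 2 = Vd)
    (hQdisj : ∀ r r' : Fin 3, r ≠ r' → Disjoint (Q r) (Q r'))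
    (hQref : ∀ r, Q r ⊆ A₁ ∨ Q r ⊆ A₂) :
    (∃ w : Fin 3 → V, Function.Injective w ∧
      ∀ r, w r ∈ Vc ∧ ∃ u ∈ Q r, G.Adj u (w r)) ∧
    (∀ P₁ P₂ : Set V, P₁ ∪ P₂ = Vc → Disjoint P₁ P₂ →
      P₁.Nonempty → P₂.Nonempty →
      ∃ w : Fin 3 → V, Function.Injective w ∧
        (∀ r, w r ∈ Vc ∧ ∃ u ∈ Q r, G.Adj u (w r)) ∧
        (({w 0, w 1, w 2} : Set V) ∩ P₁).ncard ≤ 2 ∧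
        (({w 0, w 1, w 2} : Set V) ∩ P₂).ncard ≤ 2) := by
  classical
  have hQVd : ∀ r, Q r ⊆ Vd := by
    intro r u hu
    rw [← hQunion]
    fin_cases r
    exacts [Or.inl (Or.inl hu), Or.inl (Or.inr hu), Or.inr hu]
  have hQcover : ∀ u ∈ Vd, ∃ r, u ∈ Q r := by
    intro u hu
    rw [← hQunion] at hu
    rcases hu with (hu | hu) | hu
    exacts [⟨0, hu⟩, ⟨1, hu⟩, ⟨2, hu⟩]
  obtain ⟨a, ha, b, hb, hab⟩ : ∃ a ∈ Vd, ∃ b ∈ Vc, G.Adj a b := by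
    obtain ⟨x, y, hxy⟩ := hedge
    rcases hbip x y hxy with h | h
    exacts [⟨x, h.1, y, h.2, hxy⟩, ⟨y, h.2, x, h.1, hxy.symm⟩]
  have hd₁ : 0 < d₁ := by
    rw [← hreg₁ a ha, Set.ncard_pos]
    exact ⟨b, hb, hab⟩
  have hd₂ : 0 < d₂ := by
    rw [← hreg₂ b hb, Set.ncard_pos]
    exact ⟨a, ha, hab⟩
  have hcard : Vc.ncard * d₂ ≤ Vd.ncard * d₁ := by
    refine (G.ncard_mul_le_ncard_neighbors_mul (X := Vc) (Y := Vd) (m := d₂) (n := d₁)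
      subset_rfl (fun w hw => ?_) (fun u hu => ?_)).trans ?_
    · simpa only [G.adj_comm w] using (hreg₂ w hw).ge
    · simpa only [G.adj_comm _ u] using (hreg₁ u hu).le
    · exact Nat.mul_le_mul_right _ (Set.ncard_le_ncard (fun x hx => hx.1) (Set.toFinite _))
  have hVd : Vd.ncard = 2 * A₁.ncard := by
    rw [← hAunion, Set.ncard_union_eq hAdisj (Set.toFinite _) (Set.toFinite _), ← hAsize, two_mul]
  have hexp : ∀ T ⊆ Vd, T.ncard * d₁ ≤ {w ∈ Vc | ∃ u ∈ T, G.Adj u w}.ncard * d₂ := fun T hT =>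
    G.ncard_mul_le_ncard_neighbors_mul hT (fun u hu => (hreg₁ u hu).ge) (fun w hw => (hreg₂ w hw).le)
  have hall : ∀ s : Finset (Fin 3),
      s.card ≤ {w ∈ Vc | ∃ u ∈ ⋃ r ∈ s, Q r, G.Adj u w}.ncard := by
    intro s
    have hT : (⋃ r ∈ s, Q r) ⊆ Vd := Set.iUnion₂_subset fun r _ => hQVd r
    have h := hexp _ hT
    set T := ⋃ r ∈ s, Q r with hTdef
    set N := {w ∈ Vc | ∃ u ∈ T, G.Adj u w}
    have hs3 : s.card ≤ 3 := by simpa using s.card_le_univ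
    have hmem : ∀ u, u ∈ T ↔ ∃ r ∈ s, u ∈ Q r := by simp [hTdef]
    rcases Nat.lt_or_ge s.card 2 with hs | hs
    · rcases s.eq_empty_or_nonempty with rfl | ⟨r, hr⟩
      · simp
      · obtain ⟨u, hu⟩ := hQne r
        have hTpos : 0 < T.ncard := (Set.ncard_pos (Set.toFinite _)).2 ⟨u, (hmem u).2 ⟨r, hr, hu⟩⟩
        have hN : 0 < N.ncard := Nat.pos_of_mul_pos_right ((Nat.mul_pos hTpos hd₁).trans_le h)
        omega
    · by_cases hsu : s = Finset.univ
      · have hTV : Vd ⊆ T := fun u hu => by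
          obtain ⟨r, hr⟩ := hQcover u hu
          exact (hmem u).2 ⟨r, by simp [hsu], hr⟩
        have h1 := Nat.mul_le_mul_right d₁ (Set.ncard_le_ncard hTV (Set.toFinite _))
        have := Nat.le_of_mul_le_mul_right (hcard.trans (h1.trans h)) hd₂
        omega
      · have hlt : s.card < 3 := by simpa using (Finset.card_lt_iff_ne_univ s).2 hsu
        obtain ⟨r, hr⟩ : ∃ r, sᶜ = {r} := by
          rw [← Finset.card_eq_one, Finset.card_compl, Fintype.card_fin]
          omega
        have hin : ∀ u ∈ Vd, u ∉ Q r → u ∈ T := by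
          intro u hu hur
          obtain ⟨i, hi⟩ := hQcover u hu
          refine (hmem u).2 ⟨i, ?_, hi⟩
          by_contra his
          rw [← Finset.mem_compl, hr, Finset.mem_singleton] at his
          exact hur (his ▸ hi)
        have hA : A₁.ncard ≤ T.ncard := by
          rcases hQref r with hr | hr
          · rw [hAsize]
            exact Set.ncard_le_ncard (fun u hu => hin u (hAunion ▸ Or.inr hu)
              fun hur => Set.disjoint_left.mp hAdisj (hr hur) hu) (Set.toFinite _)
          · exact Set.ncard_le_ncard (fun u hu => hin u (hAunion ▸ Or.inl hu)
              fun hur => Set.disjoint_left.mp hAdisj hu (hr hur)) (Set.toFinite _)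
        have h1 : A₁.ncard * d₁ ≤ N.ncard * d₂ := (Nat.mul_le_mul_right _ hA).trans h
        have h2 : Vc.ncard * d₂ ≤ (2 * N.ncard) * d₂ := by
          rw [hVd] at hcard
          linarith
        have := Nat.le_of_mul_le_mul_right h2 hd₂
        omega
  obtain ⟨w, hinj, hw⟩ : ∃ w : Fin 3 → V, Function.Injective w ∧
      ∀ r, w r ∈ Vc ∧ ∃ u ∈ Q r, G.Adj u (w r) := by
    obtain ⟨w, hinj, hw⟩ := (Finset.all_card_le_biUnion_card_iff_exists_injective
      (fun r => {w ∈ Vc | ∃ u ∈ Q r, G.Adj u w}.toFinset)).1 (fun s => by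
        refine (hall s).trans ?_
        rw [← Set.ncard_coe_finset]
        refine Set.ncard_le_ncard (fun x hx => ?_) (Set.toFinite _)
        obtain ⟨hxc, u, hu, hux⟩ := hx
        obtain ⟨r, hr, hur⟩ := Set.mem_iUnion₂.1 hu
        exact Finset.mem_coe.2 (Finset.mem_biUnion.2
          ⟨r, hr, Set.mem_toFinset.2 ⟨hxc, u, hur, hux⟩⟩))
    exact ⟨w, hinj, fun r => by simpa using hw r⟩
  refine ⟨⟨w, hinj, hw⟩, fun P₁ P₂ hP hPdisj hP₁ hP₂ => ?_⟩
  have hnbr : ∀ x ∈ Vc, ∃ r, x ∈ Vc ∧ ∃ u ∈ Q r, G.Adj u x := by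
    intro x hx
    obtain ⟨u, hu, hux⟩ := (Set.ncard_pos (Set.toFinite _)).1 (hd₂.trans_eq (hreg₂ x hx).symm)
    obtain ⟨r, hr⟩ := hQcover u hu
    exact ⟨r, hx, u, hr, hux⟩
  obtain ⟨w', hinj', hw', ⟨r, hr⟩, ⟨s, hs⟩⟩ : ∃ w' : Fin 3 → V, Function.Injective w' ∧
      (∀ r, w' r ∈ Vc ∧ ∃ u ∈ Q r, G.Adj u (w' r)) ∧ (∃ r, w' r ∉ P₁) ∧ ∃ r, w' r ∉ P₂ := by
    by_cases h₁ : ∀ r, w r ∈ P₁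
    · obtain ⟨x, hx⟩ := hP₂
      exact exists_transversal_meeting_both (R := fun r x => x ∈ Vc ∧ ∃ u ∈ Q r, G.Adj u x)
        hPdisj hinj hw h₁ hx (hnbr x (hP ▸ Or.inr hx))
    by_cases h₂ : ∀ r, w r ∈ P₂
    · obtain ⟨x, hx⟩ := hP₁
      obtain ⟨w', hi, hR, hp, hq⟩ := exists_transversal_meeting_both
        (R := fun r x => x ∈ Vc ∧ ∃ u ∈ Q r, G.Adj u x)
        hPdisj.symm hinj hw h₂ hx (hnbr x (hP ▸ Or.inl hx))
      exact ⟨w', hi, hR, hq, hp⟩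
    exact ⟨w, hinj, hw, not_forall.1 h₁, not_forall.1 h₂⟩
  exact ⟨w', hinj', hw', Set.ncard_triple_inter_le_two w' hr, Set.ncard_triple_inter_le_two w' hs⟩
end

section
/- Let G be a finite simple graph, χ a 1-stable coloring of G, and v ∈ V(G) a vertex with [v]_χ = {v}. Let c_1, …, c_k be distinct colors in the image of χ, all different from χ(v), such that: some neighbor of v has color c_1, and for each i ∈ {1, …, k−1} some edge of G joins a vertex of color c_i to a vertex of color c_{i+1}. Then the subgraph of G induced on {v} ∪ χ^{-1}(c_1) ∪ … ∪ χ^{-1}(c_k) is connected. (This is the connectivity claim used in the proof of the find-small-color-class lemma.) -/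
/-- A vertex coloring is 1-stable for `G`: equally colored vertices have, for every
color `a`, the same number of neighbors of color `a`. -/
def IsOneStable {V C : Type*} (G : SimpleGraph V) (χ : V → C) : Prop :=
  ∀ u v : V, χ u = χ v →
    ∀ a : C, {w : V | G.Adj u w ∧ χ w = a}.ncard = {w : V | G.Adj v w ∧ χ w = a}.ncard

/-- In a 1-stable coloring, equally colored vertices see the same colors. -/
theorem IsOneStable.exists_adj {V C : Type*} [Finite V] {G : SimpleGraph V} {χ : V → C}
    (hχ : IsOneStable G χ) {u u' w : V} (hu : χ u = χ u') (hw : G.Adj u w) :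
    ∃ w', G.Adj u' w' ∧ χ w' = χ w := by
  have hpos : 0 < {x : V | G.Adj u x ∧ χ x = χ w}.ncard :=
    (Set.ncard_pos (Set.toFinite _)).2 ⟨w, hw, rfl⟩
  rw [hχ u u' hu] at hpos
  exact (Set.ncard_pos (Set.toFinite _)).1 hpos

theorem stmt14 {V C : Type*} [Fintype V] (G : SimpleGraph V) (χ : V → C)
    (hχ : IsOneStable G χ) (v : V)
    (hsing : {w : V | χ w = χ v} = {v})
    (k : ℕ) (hk : 1 ≤ k) (c : Fin k → C) (hcinj : Function.Injective c)
    (hcim : ∀ i, ∃ w : V, χ w = c i) (hcv : ∀ i, c i ≠ χ v)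
    (hfirst : ∃ w : V, G.Adj v w ∧ χ w = c ⟨0, hk⟩)
    (hchain : ∀ i : Fin k, ∀ h : (i : ℕ) + 1 < k,
      ∃ x y : V, χ x = c i ∧ χ y = c ⟨(i : ℕ) + 1, h⟩ ∧ G.Adj x y) :
    (G.induce ({v} ∪ ⋃ i : Fin k, {w : V | χ w = c i})).Connected := by
  set S : Set V := {v} ∪ ⋃ i : Fin k, {w : V | χ w = c i}
  have hvS : v ∈ S := Or.inl rfl
  have hcS (i : Fin k) (w : V) (hw : χ w = c i) : w ∈ S := Or.inr (Set.mem_iUnion.2 ⟨i, hw⟩)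
  have hreach (n : ℕ) : ∀ (h : n < k) (w : V) (hw : χ w = c ⟨n, h⟩),
      (G.induce S).Reachable ⟨v, hvS⟩ ⟨w, hcS _ w hw⟩ := by
    induction n with
    | zero =>
      intro h w hw
      obtain ⟨x, hvx, hx⟩ := hfirst
      obtain ⟨y, hwy, hy⟩ := hχ.exists_adj (hx.trans hw.symm) hvx.symm
      obtain rfl : y = v := hsing.subset hy
      exact SimpleGraph.Adj.reachable (SimpleGraph.induce_adj.2 hwy.symm)
    | succ n ih =>
      intro h w hw
      obtain ⟨x, y, hx, hy, hxy⟩ := hchain ⟨n, by omega⟩ h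
      obtain ⟨z, hwz, hz⟩ := hχ.exists_adj (hy.trans hw.symm) hxy.symm
      exact (ih (by omega) z (hz.trans hx)).trans
        (SimpleGraph.Adj.reachable (SimpleGraph.induce_adj.2 hwz.symm))
  refine (SimpleGraph.connected_iff_exists_forall_reachable _).2 ⟨⟨v, hvS⟩, ?_⟩
  rintro ⟨w, rfl | hw⟩
  · exact SimpleGraph.Reachable.rfl
  · obtain ⟨i, hi⟩ := Set.mem_iUnion.1 hw
    exact hreach i i.2 w hi
end
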